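/- arXiv:1310.3745 — 2 statements merged into one kernel-verified Lean document; each statement's English description precedes it below -/
import Mathlib

section
/- Let Σ and M be symmetric n×n real matrices. Let λ_1 ≥ λ_2 > λ_3 ≥ … ≥ λ_n be the eigenvalues of Σ with corresponding orthonormal eigenvectors u_1, u_2, …, u_n, and let ũ_1, ũ_2 be orthonormal eigenvectors of M corresponding to its two largest eigenvalues. If ‖M − Σ‖ ≤ ε for some ε < (λ_2 − λ_3)/2, then for i = 1, 2: ‖ũ_i − P ũ_i‖₂² ≤ 4ε/(λ_2 − λ_3), where P denotes the orthogonal projection onto the span of {u_1, u_2}. -/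
open scoped RealInnerProductSpace

section Diagonal

variable {ι E : Type*} [Fintype ι] [NormedAddCommGroup E] [InnerProductSpace ℝ E]

lemma OrthonormalBasis.inner_apply_self_eq_sum_of_eigenvectors
    (b : OrthonormalBasis ι ℝ E) (A : E →L[ℝ] E) (lam : ι → ℝ)
    (hA : ∀ j, A (b j) = lam j • b j) (x : E) :
    ⟪x, A x⟫ = ∑ j, lam j * ⟪b j, x⟫ ^ 2 := by
  conv_lhs => enter [3, 2]; rw [← b.sum_repr' x]
  rw [map_sum, inner_sum]
  refine Finset.sum_congr rfl fun j _ => ?_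
  rw [map_smul, hA, inner_smul_right, inner_smul_right, real_inner_comm]
  ring

lemma OrthonormalBasis.inner_apply_self_le_of_eigenvectors
    (b : OrthonormalBasis ι ℝ E) (A : E →L[ℝ] E) (lam : ι → ℝ)
    (hA : ∀ j, A (b j) = lam j • b j) {x : E} {c : ℝ}
    (hx : ∀ j, ⟪b j, x⟫ = 0 ∨ lam j ≤ c) :
    ⟪x, A x⟫ ≤ c * ‖x‖ ^ 2 := by
  rw [b.inner_apply_self_eq_sum_of_eigenvectors A lam hA, ← b.sum_sq_inner_right,
    Finset.mul_sum]
  refine Finset.sum_le_sum fun j _ => ?_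
  rcases hx j with h | h
  · simp [h]
  · gcongr

lemma OrthonormalBasis.le_inner_apply_self_of_eigenvectors
    (b : OrthonormalBasis ι ℝ E) (A : E →L[ℝ] E) (lam : ι → ℝ)
    (hA : ∀ j, A (b j) = lam j • b j) {x : E} {c : ℝ}
    (hx : ∀ j, ⟪b j, x⟫ = 0 ∨ c ≤ lam j) :
    c * ‖x‖ ^ 2 ≤ ⟪x, A x⟫ := by
  rw [b.inner_apply_self_eq_sum_of_eigenvectors A lam hA, ← b.sum_sq_inner_right,
    Finset.mul_sum]
  refine Finset.sum_le_sum fun j _ => ?_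
  rcases hx j with h | h
  · simp [h]
  · gcongr

lemma inner_apply_le_of_opNorm_le {A : E →L[ℝ] E} {ε : ℝ} (hA : ‖A‖ ≤ ε) (x y : E) :
    ⟪x, A y⟫ ≤ ε * (‖x‖ * ‖y‖) :=
  calc ⟪x, A y⟫ ≤ ‖x‖ * ‖A y‖ := real_inner_le_norm _ _
    _ ≤ ‖x‖ * (ε * ‖y‖) := by gcongr; exact A.le_of_opNorm_le hA y
    _ = ε * (‖x‖ * ‖y‖) := by ring

lemma exists_smul_add_smul_ne_zero_inner_eq_zero {u₀ u₁ : E}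
    (h : LinearIndependent ℝ ![u₀, u₁]) (w : E) :
    ∃ a b : ℝ, a • u₀ + b • u₁ ≠ 0 ∧ ⟪w, a • u₀ + b • u₁⟫ = 0 := by
  rw [LinearIndependent.pair_iff] at h
  by_cases hw : ⟪w, u₁⟫ = 0
  · refine ⟨0, 1, fun h0 => ?_, by simp [hw]⟩
    simpa using (h _ _ h0).2
  · refine ⟨⟪w, u₁⟫, -⟪w, u₀⟫, fun h0 => hw (h _ _ h0).1, ?_⟩
    simp only [inner_add_right, inner_smul_right]
    ring

/-- Weyl's inequality for the second largest eigenvalue. -/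
lemma OrthonormalBasis.second_eigenvalue_sub_le
    (u w : OrthonormalBasis ι ℝ E) (A B : E →L[ℝ] E) (lam mu : ι → ℝ)
    (hA : ∀ j, A (u j) = lam j • u j) (hB : ∀ j, B (w j) = mu j • w j)
    {i₀ i₁ : ι} (hne : i₀ ≠ i₁) (hlam : lam i₁ ≤ lam i₀)
    (hmu : ∀ j, j ≠ i₀ → mu j ≤ mu i₁) {ε : ℝ} (hε : ‖B - A‖ ≤ ε) :
    lam i₁ - ε ≤ mu i₁ := by
  have hli : LinearIndependent ℝ ![u i₀, u i₁] := by
    have := u.orthonormal.linearIndependent.comp ![i₀, i₁] (by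
      intro a b; fin_cases a <;> fin_cases b <;> simp [hne, hne.symm])
    rwa [show ⇑u ∘ ![i₀, i₁] = ![u i₀, u i₁] by ext a; fin_cases a <;> rfl] at this
  obtain ⟨a, b, hx0, hwx⟩ := exists_smul_add_smul_ne_zero_inner_eq_zero hli (w i₀)
  set x := a • u i₀ + b • u i₁ with hx
  have h1 : lam i₁ * ‖x‖ ^ 2 ≤ ⟪x, A x⟫ :=
    u.le_inner_apply_self_of_eigenvectors A lam hA fun j => by
      by_cases h0 : j = i₀
      · exact .inr (h0 ▸ hlam)
      by_cases h1 : j = i₁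
      · exact .inr (h1 ▸ le_rfl)
      left
      simp [hx, inner_add_right, inner_smul_right, u.inner_eq_zero h0, u.inner_eq_zero h1]
  have h2 : ⟪x, B x⟫ ≤ mu i₁ * ‖x‖ ^ 2 :=
    w.inner_apply_self_le_of_eigenvectors B mu hB fun j => by
      by_cases h0 : j = i₀
      · exact .inl (h0 ▸ hwx)
      · exact .inr (hmu j h0)
  have hε' : ‖A - B‖ ≤ ε := by rwa [norm_sub_rev]
  have h3 := inner_apply_le_of_opNorm_le hε' x x
  rw [sub_apply, inner_sub_right] at h3
  have h4 : 0 < ‖x‖ ^ 2 := by positivity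
  refine le_of_mul_le_mul_right ?_ h4
  linarith

/-- The residual of a unit eigenvector of `B` after projecting onto two eigenvectors of `A`. -/
lemma OrthonormalBasis.mul_norm_sub_proj_le
    (u : OrthonormalBasis ι ℝ E) (A B : E →L[ℝ] E) (lam : ι → ℝ)
    (hA : ∀ j, A (u j) = lam j • u j) {i₀ i₁ : ι} (hne : i₀ ≠ i₁) {c : ℝ}
    (hc : ∀ j, j ≠ i₀ → j ≠ i₁ → lam j ≤ c) {ε : ℝ} (hε : ‖B - A‖ ≤ ε)
    {v : E} {μ : ℝ} (hv : ‖v‖ = 1) (hBv : B v = μ • v) :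
    (μ - c) * ‖v - (⟪u i₀, v⟫ • u i₀ + ⟪u i₁, v⟫ • u i₁)‖ ≤ ε := by
  set p := ⟪u i₀, v⟫ • u i₀ + ⟪u i₁, v⟫ • u i₁ with hp
  set r := v - p with hr
  have hr0 : ⟪u i₀, r⟫ = 0 := by
    simp [hr, hp, inner_sub_right, inner_add_right, inner_smul_right, u.inner_eq_zero hne]
  have hr1 : ⟪u i₁, r⟫ = 0 := by
    simp [hr, hp, inner_sub_right, inner_add_right, inner_smul_right, u.inner_eq_zero hne.symm]
  rw [real_inner_comm] at hr0 hr1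
  have hvrp : v = r + p := by simp [hr]
  have hrv : ⟪r, v⟫ = ‖r‖ ^ 2 := by
    conv_lhs => rw [hvrp]
    simp [hp, inner_add_right, inner_smul_right, hr0, hr1]
  have hrA : ⟪r, A v⟫ = ⟪r, A r⟫ := by
    conv_lhs => rw [hvrp]
    simp [hp, inner_add_right, inner_smul_right, hA, hr0, hr1]
  have hle : ⟪r, A r⟫ ≤ c * ‖r‖ ^ 2 :=
    u.inner_apply_self_le_of_eigenvectors A lam hA fun j => by
      by_cases h0 : j = i₀
      · left; rw [h0, real_inner_comm, hr0]
      by_cases h1 : j = i₁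
      · left; rw [h1, real_inner_comm, hr1]
      exact .inr (hc j h0 h1)
  have h3 := inner_apply_le_of_opNorm_le hε r v
  rw [sub_apply, inner_sub_right, hBv, inner_smul_right, hrv, hrA, hv] at h3
  rcases (norm_nonneg r).eq_or_lt with h0 | h0
  · rw [← h0, mul_zero]
    exact (norm_nonneg _).trans hε
  · refine le_of_mul_le_mul_right ?_ h0
    linarith

end Diagonal

lemma Matrix.toEuclideanCLM_apply_eq_smul {n : Type*} [Fintype n] [DecidableEq n]
    {S : Matrix n n ℝ} {v : EuclideanSpace ℝ n} {c : ℝ}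
    (h : ∀ i, ∑ j, S i j * v j = c * v i) :
    Matrix.toEuclideanCLM (𝕜 := ℝ) S v = c • v := by
  ext i
  simpa [Matrix.mulVec, dotProduct] using h i

lemma sq_le_four_mul_div_of_sub_mul_le {g ε r : ℝ} (hε : 0 ≤ ε) (hg : ε < g / 2)
    (hr : 0 ≤ r) (h : (g - ε) * r ≤ ε) : r ^ 2 ≤ 4 * ε / g := by
  have hg0 : 0 < g := by linarith
  have hr1 : r ≤ 1 := by
    by_contra! h1
    nlinarith
  rw [le_div_iff₀ hg0]
  nlinarith [mul_nonneg hr (sub_nonneg.2 hr1), mul_nonneg hr (sub_nonneg.2 hg.le)]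

/-- **Eigenspace perturbation (Lemma 4(a), 'MatBound').**
Let `Σ`, `M` be symmetric `n×n` matrices, with eigenvalues `λ₁ ≥ λ₂ > λ₃ ≥ … ≥ λₙ`
of `Σ` (orthonormal eigenvectors `u₁, …, uₙ`) and orthonormal eigenvectors
`ũ₁, ũ₂` of `M` for its two largest eigenvalues.  If `‖M − Σ‖ ≤ ε < (λ₂ − λ₃)/2`
then `‖ũᵢ − P ũᵢ‖² ≤ 4ε/(λ₂ − λ₃)` for `i = 1, 2`, where `P` is the orthogonal
projection onto `span{u₁, u₂}`. -/
theorem eigenspace_perturbation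
    (n : ℕ) [NeZero n] (hn : 3 ≤ n)
    (S M : Matrix (Fin n) (Fin n) ℝ) (hS : S.IsHermitian) (hM : M.IsHermitian)
    (lam : Fin n → ℝ) (hlam : Antitone lam) (hgap : lam 2 < lam 1)
    (u : Fin n → EuclideanSpace ℝ (Fin n)) (hu : Orthonormal ℝ u)
    (hSu : ∀ m i, ∑ j, S i j * u m j = lam m * u m i)
    (mu : Fin n → ℝ) (hmu : Antitone mu)
    (w : Fin n → EuclideanSpace ℝ (Fin n)) (hw : Orthonormal ℝ w)
    (hMw : ∀ m i, ∑ j, M i j * w m j = mu m * w m i)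
    (ε : ℝ) (hε : ‖Matrix.toEuclideanCLM (𝕜 := ℝ) (M - S)‖ ≤ ε)
    (hεgap : ε < (lam 1 - lam 2) / 2) :
    ∀ m : Fin n, m = 0 ∨ m = 1 →
      ‖w m - (⟪u 0, w m⟫ • u 0 + ⟪u 1, w m⟫ • u 1)‖ ^ 2 ≤ 4 * ε / (lam 1 - lam 2) := by
  have h1v : (1 : Fin n).val = 1 := Nat.mod_eq_of_lt (show 1 < n by omega)
  have h2v : (2 : Fin n).val = 2 := Nat.mod_eq_of_lt (show 2 < n by omega)
  have h01 : (0 : Fin n) ≠ 1 := fun h => by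
    have := congrArg Fin.val h
    rw [h1v, Fin.val_zero] at this
    omega
  have hone : ∀ j : Fin n, j ≠ 0 → 1 ≤ j := fun j hj => by
    rw [Fin.le_def, h1v]
    exact Nat.one_le_iff_ne_zero.2 (Fin.val_ne_zero_iff.2 hj)
  have htwo : ∀ j : Fin n, j ≠ 0 → j ≠ 1 → 2 ≤ j := fun j hj hj1 => by
    have := Fin.lt_def.1 (lt_of_le_of_ne (hone j hj) hj1.symm)
    rw [Fin.le_def]
    omega
  have hspan {v : Fin n → EuclideanSpace ℝ (Fin n)} (hv : Orthonormal ℝ v) :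
      ⊤ ≤ Submodule.span ℝ (Set.range v) :=
    (hv.linearIndependent.span_eq_top_of_card_eq_finrank' (by simp)).ge
  let bu := OrthonormalBasis.mk hu (hspan hu)
  let bw := OrthonormalBasis.mk hw (hspan hw)
  have hbu : ⇑bu = u := OrthonormalBasis.coe_mk hu _
  have hbw : ⇑bw = w := OrthonormalBasis.coe_mk hw _
  rw [map_sub] at hε
  have hA (j) : Matrix.toEuclideanCLM (𝕜 := ℝ) S (bu j) = lam j • bu j := by
    rw [hbu]; exact Matrix.toEuclideanCLM_apply_eq_smul (hSu j)
  have hB (j) : Matrix.toEuclideanCLM (𝕜 := ℝ) M (bw j) = mu j • bw j := by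
    rw [hbw]; exact Matrix.toEuclideanCLM_apply_eq_smul (hMw j)
  have hweyl := bu.second_eigenvalue_sub_le bw _ _ lam mu hA hB h01
    (hlam (Fin.zero_le _)) (fun j hj => hmu (hone j hj)) hε
  intro m hm
  have hmu1 : mu 1 ≤ mu m := by
    rcases hm with rfl | rfl
    · exact hmu (Fin.zero_le _)
    · exact le_rfl
  have hres := bu.mul_norm_sub_proj_le _ _ lam hA h01
    (fun j h0 h1 => hlam (htwo j h0 h1)) hε (bw.orthonormal.1 m) (hB m)
  rw [hbu, hbw] at hres
  refine sq_le_four_mul_div_of_sub_mul_le ((norm_nonneg _).trans hε) hεgap (norm_nonneg _)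
    (le_trans ?_ hres)
  gcongr ?_ * _
  linarith
end

section
/- Let β_1, β_2, β_1*, β_2* ∈ ℝ^k, let J be a finite index set, and for each i ∈ J let x_i ∈ ℝ^k and y_i ∈ ℝ satisfy y_i = ⟨x_i, β_2*⟩ (the sample comes from β_2*) and (y_i − ⟨x_i, β_1⟩)² ≤ (y_i − ⟨x_i, β_2⟩)² (the sample is assigned to the first component by the EM decision rule). Then Σ_{i∈J} ⟨x_i, β_1* − β_2*⟩² ≤ Σ_{i∈J} [ 2⟨x_i, β_1* − β_1⟩² + 2⟨x_i, β_2* − β_2⟩² ]. -/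
open scoped RealInnerProductSpace

/-- **Key deterministic inequality in bounding the term `B` (proof of Theorem 1).**
If each sample `i ∈ J` comes from `β₂*` (i.e. `yᵢ = ⟨xᵢ, β₂*⟩`) but is assigned to
the first component by the EM rule (`(yᵢ − ⟨xᵢ,β₁⟩)² ≤ (yᵢ − ⟨xᵢ,β₂⟩)²`), then
`∑_{i∈J} ⟨xᵢ, β₁* − β₂*⟩² ≤ ∑_{i∈J} [2⟨xᵢ, β₁* − β₁⟩² + 2⟨xᵢ, β₂* − β₂⟩²]`. -/
theorem em_misassigned_samples_bound
    (k : ℕ) (β₁ β₂ β₁s β₂s : EuclideanSpace ℝ (Fin k))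
    (ι : Type*) (J : Finset ι)
    (x : ι → EuclideanSpace ℝ (Fin k)) (y : ι → ℝ)
    (hgen : ∀ i ∈ J, y i = ⟪x i, β₂s⟫)
    (hassign : ∀ i ∈ J, (y i - ⟪x i, β₁⟫) ^ 2 ≤ (y i - ⟪x i, β₂⟫) ^ 2) :
    ∑ i ∈ J, ⟪x i, β₁s - β₂s⟫ ^ 2
      ≤ ∑ i ∈ J, (2 * ⟪x i, β₁s - β₁⟫ ^ 2 + 2 * ⟪x i, β₂s - β₂⟫ ^ 2) := by
  refine Finset.sum_le_sum fun i hi => ?_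
  have h := hassign i hi
  rw [hgen i hi] at h
  simp only [inner_sub_right]
  linarith [sq_nonneg (⟪x i, β₁s⟫ - 2 * ⟪x i, β₁⟫ + ⟪x i, β₂s⟫)]
end
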